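/- Let A be a finite nonempty linearly ordered set with maximum m, and let K be an A-cubical complex. Then the set of critical cells of the discrete vector field V^r_K := {(λ,μ) ∈ V^r_A : λ, μ ∈ P_K} on the subset P^r_K := P^r_A ∩ P_K equals R_K, the union over all branching sequences (C,B,D) of K of the sets R_{(C,B,D)} = {π|m|B|ρ : π ∈ P_{K|_C^0}, ρ ∈ P_{K|_D^1}}. -/

import Mathlib

section Core

variable {A : Type*} [DecidableEq A] [Fintype A]

/-- A cube of the standard `A`-cube: `none` means `*`, `some true` means `1`,
`some false` means `0`. -/
abbrev Cube (A : Type*) := A → Option Bool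

/-- The cube `c(O, S, rest)` with value `1` on `O`, `*` on `S` and `0` elsewhere. -/
def cubeOn (O S : Finset A) : Cube A := fun a =>
  if a ∈ S then none else if a ∈ O then some true else some false

/-- An `A`-cubical complex: a set of cubes closed under the face maps, i.e. under
replacing any occurrence of `*` by `0` or `1`. -/
def IsComplex (K : Set (Cube A)) : Prop :=
  ∀ c ∈ K, ∀ a : A, c a = none → ∀ ε : Bool, Function.update c a (some ε) ∈ K

/-- Union of the blocks of a list of finsets. -/
def blocksUnion (L : List (Finset A)) : Finset A := L.foldr (· ∪ ·) ∅

/-- `L` is an ordered partition of `S`: a sequence of nonempty pairwise disjoint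
subsets whose union is `S`. -/
def IsOPart (S : Finset A) (L : List (Finset A)) : Prop :=
  (∀ B ∈ L, B.Nonempty) ∧
    List.Pairwise (fun B C : Finset A => Disjoint B C) L ∧ blocksUnion L = S

/-- The set `P_K` of ordered partitions `L = B₁|…|B_l` of `S` such that each cube
`c((O ∪ B₁∪…∪B_{i-1}), B_i, rest)` belongs to `K`.  Here `O` records the part of the
ambient set on which the cubes take the fixed value `1` (used for the restrictions
`K|_B^ε`); for the full complex take `O = ∅`, `S = univ`. -/
def PK (K : Set (Cube A)) (O S : Finset A) : Set (List (Finset A)) :=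
  {L | IsOPart S L ∧ ∀ (i : ℕ) (h : i < L.length),
    cubeOn (O ∪ blocksUnion (L.take i)) (L[i]'h) ∈ K}

/-- `x` refines `y`: the blocks of `y` are obtained by uniting consecutive blocks of `x`. -/
def Refines (x y : List (Finset A)) : Prop :=
  ∃ LL : List (List (Finset A)), (∀ l ∈ LL, l ≠ []) ∧
    x = LL.flatten ∧ y = LL.map blocksUnion

/-- Dimension of an ordered partition: `Σ (#Bᵢ - 1)`. -/
def pdim (L : List (Finset A)) : ℕ := (L.map fun B => B.card - 1).sum

/-- The facet relation on ordered partitions. -/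
def PFacet (x y : List (Finset A)) : Prop :=
  Refines x y ∧ x ≠ y ∧ pdim y = pdim x + 1

/-- A cycle of a discrete vector field on a poset of ordered partitions. -/
def PCycle (V : Set (List (Finset A) × List (Finset A))) (k : ℕ)
    (a : Fin (k + 1) → List (Finset A)) (b : Fin k → List (Finset A)) : Prop :=
  0 < k ∧ a 0 = a (Fin.last k) ∧
    ∀ i : Fin k, (a i.castSucc, b i) ∈ V ∧ (a i.succ, b i) ∉ V ∧ PFacet (a i.succ) (b i)

/-- A discrete vector field on ordered partitions is a gradient field if it has no cycle. -/
def PGradient (V : Set (List (Finset A) × List (Finset A))) : Prop :=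
  ∀ k a b, ¬ PCycle V k a b

/-- Critical cells of a discrete vector field `V` on the set of cells `S`. -/
def CritOn (S : Set (List (Finset A)))
    (V : Set (List (Finset A) × List (Finset A))) : Set (List (Finset A)) :=
  {x | x ∈ S ∧ ∀ p ∈ V, p.1 ≠ x ∧ p.2 ≠ x}

end Core
/-- The maximal element of a finite nonempty linearly ordered set. -/
def mA (A : Type*) [LinearOrder A] [Fintype A] [Nonempty A] : A :=
  Finset.univ.max' Finset.univ_nonempty

section VrA

variable {A : Type*} [LinearOrder A] [Fintype A]

/-- `P^m_A`: ordered partitions of `A` of the form `λ|m`. -/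
def PmA (m : A) : Set (List (Finset A)) :=
  {L | ∃ L', IsOPart (Finset.univ.erase m) L' ∧ L = L' ++ [({m} : Finset A)]}

/-- `P^r_A = P_A ∖ P^m_A`. -/
def PrA (m : A) : Set (List (Finset A)) :=
  {L | IsOPart Finset.univ L} \ PmA m

/-- The discrete vector field `V^r_A` on `P^r_A`. -/
def VrA (m : A) : Set (List (Finset A) × List (Finset A)) :=
  {p | ∃ (C B D : Finset A) (π ρ : List (Finset A)),
    B.Nonempty ∧ Disjoint C B ∧ Disjoint C D ∧ Disjoint B D ∧
    C ∪ B ∪ D = Finset.univ.erase m ∧ IsOPart C π ∧ IsOPart D ρ ∧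
    p = (π ++ [({m} : Finset A)] ++ [B] ++ ρ, π ++ [insert m B] ++ ρ)}

/-- The function `h_A(λ) = (#C, #B)` where `λ = π|B|ρ` is the unique presentation
with `m ∈ B`, `π` a partition of `C` and `ρ` a partition of `D`. -/
def hAf (m : A) (L : List (Finset A)) : ℤ × ℤ :=
  (((L.takeWhile fun B => decide (m ∉ B)).foldr (· ∪ ·) (∅ : Finset A)).card,
    match L.dropWhile fun B => decide (m ∉ B) with
    | [] => 0
    | B :: _ => B.card)

end VrA

/-- The order `≤̇` on `ℤ × ℤ₊`: `(s,t) ≤̇ (s',t')` iff `s > s'`, or `s = s'` and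
`1 ≠ t ≤ t'`, or `s = s'` and `t' = 1`. -/
def dotLE (x y : ℤ × ℤ) : Prop :=
  y.1 < x.1 ∨ (x.1 = y.1 ∧ x.2 ≠ 1 ∧ x.2 ≤ y.2) ∨ (x.1 = y.1 ∧ y.2 = 1)

/-- The strict version of `≤̇`. -/
def dotLT (x y : ℤ × ℤ) : Prop := dotLE x y ∧ x ≠ y
section Branch

variable {A : Type*} [DecidableEq A] [Fintype A]

/-- `(C,B,D)` is a branching sequence of `K`: `A = C ⊔ {m} ⊔ B ⊔ D`, `B ≠ ∅`,
`c(C, B∪{m}, D) ∉ K`, while `c(C, {m}, B∪D) ∈ K` and `c(C∪{m}, B, D) ∈ K`. -/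
def IsBranch (K : Set (Cube A)) (m : A) (C B D : Finset A) : Prop :=
  B.Nonempty ∧ Disjoint C B ∧ Disjoint C D ∧ Disjoint B D ∧
    C ∪ B ∪ D = Finset.univ.erase m ∧
    cubeOn C (insert m B) ∉ K ∧ cubeOn C {m} ∈ K ∧ cubeOn (insert m C) B ∈ K

end Branch

/-- `V^r_K = {(λ,μ) ∈ V^r_A : λ, μ ∈ P_K}`. -/
def VrK {A : Type*} [LinearOrder A] [Fintype A] (K : Set (Cube A)) (m : A) :
    Set (List (Finset A) × List (Finset A)) :=
  {p | p ∈ VrA m ∧ p.1 ∈ PK K ∅ Finset.univ ∧ p.2 ∈ PK K ∅ Finset.univ}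

section CubeFaces

variable {A : Type*} [DecidableEq A] [Fintype A]

/-- A complex contains every iterated face of its cubes. -/
theorem IsComplex.mem_of_face {K : Set (Cube A)} (hK : IsComplex K) {c c' : Cube A}
    (hc : c ∈ K) (h : ∀ a, c a = none ∨ c' a = c a) : c' ∈ K := by
  have key : ∀ s : Finset A, s.piecewise c' c ∈ K := by
    intro s
    induction s using Finset.induction_on with
    | empty => simpa using hc
    | insert j s hj ih =>
      rw [Finset.piecewise_insert]
      have hval : s.piecewise c' c j = c j := Finset.piecewise_eq_of_notMem _ _ _ hj
      rcases h j with h0 | h0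
      · rcases hcj : c' j with _ | ε
        · rwa [← h0, ← hval, Function.update_eq_self]
        · exact hK _ ih j (hval.trans h0) ε
      · rwa [h0, ← hval, Function.update_eq_self]
  simpa using key Finset.univ

theorem IsComplex.cubeOn_mem {K : Set (Cube A)} (hK : IsComplex K) {O O' S T : Finset A}
    (hc : cubeOn O S ∈ K) (hT : T ⊆ S) (hO : ∀ a ∉ S, a ∈ O' ↔ a ∈ O) :
    cubeOn O' T ∈ K := by
  refine hK.mem_of_face hc fun a => ?_
  by_cases ha : a ∈ S
  · exact Or.inl (if_pos ha)
  · have haT : a ∉ T := fun h => ha (hT h)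
    exact Or.inr (by simp [cubeOn, ha, haT, hO a ha])

end CubeFaces

section OrderedPartitions

variable {A : Type*} [DecidableEq A]

@[simp]
theorem blocksUnion_nil : blocksUnion ([] : List (Finset A)) = ∅ := rfl

@[simp]
theorem blocksUnion_cons (B : Finset A) (L : List (Finset A)) :
    blocksUnion (B :: L) = B ∪ blocksUnion L := rfl

@[simp]
theorem blocksUnion_append (L M : List (Finset A)) :
    blocksUnion (L ++ M) = blocksUnion L ∪ blocksUnion M := by
  induction L with
  | nil => simp
  | cons B L ih => simp [ih]

theorem mem_blocksUnion {L : List (Finset A)} {a : A} :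
    a ∈ blocksUnion L ↔ ∃ B ∈ L, a ∈ B := by
  induction L with
  | nil => simp
  | cons B L ih => simp [ih]

theorem disjoint_blocksUnion_right {s : Finset A} {L : List (Finset A)} :
    Disjoint s (blocksUnion L) ↔ ∀ B ∈ L, Disjoint s B := by
  induction L with
  | nil => simp
  | cons B L ih => simp [ih]

theorem isOPart_nil {S : Finset A} : IsOPart S [] ↔ S = ∅ := by
  simp [IsOPart, eq_comm]

theorem isOPart_cons {S B : Finset A} {L : List (Finset A)} :
    IsOPart S (B :: L) ↔ B.Nonempty ∧ Disjoint B (blocksUnion L) ∧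
      IsOPart (blocksUnion L) L ∧ B ∪ blocksUnion L = S := by
  simp only [IsOPart, List.mem_cons, forall_eq_or_imp, List.pairwise_cons, blocksUnion_cons,
    disjoint_blocksUnion_right]
  tauto

theorem isOPart_append {S : Finset A} {L M : List (Finset A)} :
    IsOPart S (L ++ M) ↔ IsOPart (blocksUnion L) L ∧ IsOPart (blocksUnion M) M ∧
      Disjoint (blocksUnion L) (blocksUnion M) ∧ blocksUnion L ∪ blocksUnion M = S := by
  have hd : Disjoint (blocksUnion L) (blocksUnion M) ↔ ∀ a ∈ L, ∀ b ∈ M, Disjoint a b := by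
    rw [disjoint_comm, disjoint_blocksUnion_right]
    refine forall₂_congr fun a _ => ?_
    rw [disjoint_comm, disjoint_blocksUnion_right]
  rw [hd]
  simp only [IsOPart, List.mem_append, or_imp, forall_and, List.pairwise_append,
    blocksUnion_append]
  tauto

/-- A partition with `m` in a block `insert m B` corresponds to one with that block split. -/
theorem isOPart_split_iff {m : A} {B : Finset A} (hm : m ∉ B) (hB : B.Nonempty)
    {S : Finset A} {σ τ : List (Finset A)} :
    IsOPart S (σ ++ {m} :: B :: τ) ↔ IsOPart S (σ ++ insert m B :: τ) := by
  simp only [isOPart_append, isOPart_cons, blocksUnion_cons, Finset.insert_eq,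
    Finset.disjoint_union_left, Finset.disjoint_union_right, Finset.disjoint_singleton_left,
    Finset.singleton_nonempty, Finset.union_assoc, Finset.union_nonempty]
  tauto

/-- The first block containing a given point determines the decomposition of the list. -/
theorem append_cons_inj_of_mem {m : A} {E E' : Finset A} (hE : m ∈ E) (hE' : m ∈ E') :
    ∀ {L L' M M' : List (Finset A)}, m ∉ blocksUnion L → m ∉ blocksUnion L' →
      L ++ E :: M = L' ++ E' :: M' → L = L' ∧ E = E' ∧ M = M'
  | [], [], _, _, _, _, h => by simpa using h
  | [], B :: _, _, _, _, h', h => by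
    simp only [List.nil_append, List.cons_append, List.cons.injEq] at h
    simp [← h.1, hE] at h'
  | B :: _, [], _, _, h', _, h => by
    simp only [List.nil_append, List.cons_append, List.cons.injEq] at h
    simp [h.1, hE'] at h'
  | B :: L, B' :: L', M, M', h1, h2, h => by
    simp only [List.cons_append, List.cons.injEq] at h
    simp only [blocksUnion_cons, Finset.mem_union, not_or] at h1 h2
    obtain ⟨rfl, hr⟩ := h
    obtain ⟨rfl, h4, h5⟩ := append_cons_inj_of_mem hE hE' h1.2 h2.2 hr
    exact ⟨rfl, h4, h5⟩

/-- The cubes attached to the blocks of `L`, with value `1` on `O`, all belong to `K`. -/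
def CubesIn (K : Set (Cube A)) (O : Finset A) (L : List (Finset A)) : Prop :=
  ∀ (i : ℕ) (h : i < L.length), cubeOn (O ∪ blocksUnion (L.take i)) (L[i]'h) ∈ K

theorem cubesIn_nil (K : Set (Cube A)) (O : Finset A) : CubesIn K O [] := by
  simp [CubesIn]

theorem cubesIn_cons {K : Set (Cube A)} {O B : Finset A} {L : List (Finset A)} :
    CubesIn K O (B :: L) ↔ cubeOn O B ∈ K ∧ CubesIn K (O ∪ B) L := by
  constructor
  · refine fun h => ⟨?_, fun i hi => ?_⟩
    · have h0 := h 0 (Nat.succ_pos _)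
      rwa [List.take_zero, blocksUnion_nil, Finset.union_empty] at h0
    · have h1 := h (i + 1) (Nat.succ_lt_succ hi)
      rwa [List.take_succ_cons, blocksUnion_cons, ← Finset.union_assoc] at h1
  · rintro ⟨h0, h1⟩ (_ | i) hi
    · rwa [List.take_zero, blocksUnion_nil, Finset.union_empty]
    · rw [List.take_succ_cons, blocksUnion_cons, ← Finset.union_assoc]
      exact h1 i (Nat.lt_of_succ_lt_succ hi)

theorem cubesIn_append {K : Set (Cube A)} {L M : List (Finset A)} :
    ∀ {O : Finset A}, CubesIn K O (L ++ M) ↔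
      CubesIn K O L ∧ CubesIn K (O ∪ blocksUnion L) M := by
  induction L with
  | nil => simp [cubesIn_nil]
  | cons B L ih =>
    intro O
    simp [cubesIn_cons, ih, and_assoc, Finset.union_assoc]

theorem mem_PK [Fintype A] {K : Set (Cube A)} {O S : Finset A} {L : List (Finset A)} :
    L ∈ PK K O S ↔ IsOPart S L ∧ CubesIn K O L := Iff.rfl

end OrderedPartitions

section RegularCells

variable {A : Type*} [LinearOrder A] [Fintype A]

theorem mem_PK_append_cons {K : Set (Cube A)} {σ τ : List (Finset A)} {E : Finset A} :
    σ ++ E :: τ ∈ PK K ∅ Finset.univ ↔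
      IsOPart Finset.univ (σ ++ E :: τ) ∧ CubesIn K ∅ σ ∧ cubeOn (blocksUnion σ) E ∈ K ∧
        CubesIn K (blocksUnion σ ∪ E) τ := by
  simp [mem_PK, cubesIn_append, cubesIn_cons]

/-- The blocks around `m` in an ordered partition `σ|m|B|τ` of `A`. -/
theorem isOPart_univ_split_iff {m : A} {B : Finset A} {σ τ : List (Finset A)} :
    IsOPart Finset.univ (σ ++ {m} :: B :: τ) ↔
      IsOPart (blocksUnion σ) σ ∧ IsOPart (blocksUnion τ) τ ∧ B.Nonempty ∧
        Disjoint (blocksUnion σ) B ∧ Disjoint (blocksUnion σ) (blocksUnion τ) ∧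
        Disjoint B (blocksUnion τ) ∧
        blocksUnion σ ∪ B ∪ blocksUnion τ = Finset.univ.erase m := by
  have key : (m ∉ blocksUnion σ ∧ m ∉ B ∧ m ∉ blocksUnion τ ∧
      blocksUnion σ ∪ ({m} ∪ (B ∪ blocksUnion τ)) = Finset.univ) ↔
      blocksUnion σ ∪ B ∪ blocksUnion τ = Finset.univ.erase m := by
    simp only [Finset.ext_iff, Finset.mem_union, Finset.mem_singleton, Finset.mem_univ,
      iff_true, Finset.mem_erase, and_true]
    constructor
    · rintro ⟨h1, h2, h3, h4⟩ a
      have := h4 a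
      constructor
      · rintro h rfl
        tauto
      · tauto
    · intro h
      have := h m
      refine ⟨by tauto, by tauto, by tauto, fun a => ?_⟩
      have := h a
      tauto
  rw [← key]
  simp only [isOPart_append, isOPart_cons, blocksUnion_cons,
    Finset.disjoint_union_right, Finset.disjoint_singleton_left, Finset.disjoint_singleton_right,
    Finset.singleton_nonempty]
  tauto

/-- The elements of `V^r_A` are the pairs `(σ|m|B|τ, σ|B∪{m}|τ)` of ordered partitions. -/
theorem mem_VrA {m : A} {p : List (Finset A) × List (Finset A)} :
    p ∈ VrA m ↔ ∃ (B : Finset A) (σ τ : List (Finset A)),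
      IsOPart Finset.univ (σ ++ {m} :: B :: τ) ∧
        p = (σ ++ {m} :: B :: τ, σ ++ insert m B :: τ) := by
  constructor
  · rintro ⟨C, B, D, σ, τ, hB, h1, h2, h3, h4, hσ, hτ, rfl⟩
    obtain rfl := hσ.2.2
    obtain rfl := hτ.2.2
    exact ⟨B, σ, τ, isOPart_univ_split_iff.2 ⟨hσ, hτ, hB, h1, h2, h3, h4⟩, by simp⟩
  · rintro ⟨B, σ, τ, h, rfl⟩
    obtain ⟨hσ, hτ, hB, h1, h2, h3, h4⟩ := isOPart_univ_split_iff.1 h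
    exact ⟨_, B, _, σ, τ, hB, h1, h2, h3, h4, hσ, hτ, by simp⟩

theorem notMem_of_isOPart_univ {m : A} {B : Finset A} {σ τ : List (Finset A)}
    (h : IsOPart Finset.univ (σ ++ {m} :: B :: τ)) :
    m ∉ blocksUnion σ ∧ m ∉ B ∧ m ∉ blocksUnion τ := by
  have := (isOPart_univ_split_iff.1 h).2.2.2.2.2.2
  have hm : m ∉ blocksUnion σ ∪ B ∪ blocksUnion τ := by simp [this]
  simpa only [Finset.mem_union, not_or, and_assoc] using hm

/-- Critical cells: those `σ|m|B|τ` in `P_K` for which `m` and `B` cannot be merged in `K`. -/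
theorem mem_critOn_iff {K : Set (Cube A)} (hK : IsComplex K) {m : A} {x : List (Finset A)} :
    x ∈ CritOn (PrA m ∩ PK K ∅ Finset.univ) (VrK K m) ↔
      ∃ (B : Finset A) (σ τ : List (Finset A)), x = σ ++ {m} :: B :: τ ∧
        x ∈ PK K ∅ Finset.univ ∧ cubeOn (blocksUnion σ) (insert m B) ∉ K := by
  constructor
  · rintro ⟨⟨⟨hx, hxm⟩, hxK⟩, hcrit⟩
    obtain ⟨E, hEx, hmE⟩ : ∃ E ∈ x, m ∈ E := by
      rw [← mem_blocksUnion, hx.2.2]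
      exact Finset.mem_univ m
    obtain ⟨σ, τ, rfl⟩ := List.append_of_mem hEx
    have hins : insert m (E.erase m) = E := Finset.insert_erase hmE
    rcases (E.erase m).eq_empty_or_nonempty with hE | hE
    · obtain rfl : E = {m} := by rw [← hins, hE]; rfl
      rcases τ with _ | ⟨B, τ⟩
      · refine absurd ⟨σ, ?_, rfl⟩ hxm
        obtain ⟨hσ, -, hd, hu⟩ := isOPart_append.1 hx
        convert hσ
        rw [← hu]
        simp only [blocksUnion_cons, blocksUnion_nil, Finset.union_empty,
          Finset.disjoint_singleton_right] at hd ⊢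
        ext a
        simp only [Finset.mem_erase, Finset.mem_union, Finset.mem_singleton]
        constructor
        · tauto
        · refine fun ha => ⟨?_, Or.inl ha⟩
          rintro rfl
          exact hd ha
      · refine ⟨B, σ, τ, rfl, hxK, fun hmem => ?_⟩
        have hB := (isOPart_univ_split_iff.1 hx).2.2.1
        have hmB := (notMem_of_isOPart_univ hx).2.1
        refine (hcrit (σ ++ {m} :: B :: τ, σ ++ insert m B :: τ)
          ⟨mem_VrA.2 ⟨B, σ, τ, hx, rfl⟩, hxK, ?_⟩).1 rfl
        obtain ⟨-, h1, -, h2⟩ := mem_PK_append_cons.1 hxK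
        refine mem_PK_append_cons.2 ⟨(isOPart_split_iff hmB hB).1 hx, h1, hmem, ?_⟩
        rw [Finset.insert_eq, ← Finset.union_assoc]
        exact (cubesIn_cons.1 h2).2
    · have hsplit := (isOPart_split_iff (S := Finset.univ) (σ := σ) (τ := τ)
        (Finset.notMem_erase m E) hE).2 (by rwa [hins])
      refine absurd ?_ (hcrit (σ ++ {m} :: E.erase m :: τ, σ ++ insert m (E.erase m) :: τ)
          ⟨mem_VrA.2 ⟨_, σ, τ, hsplit, rfl⟩, ?_, by simpa only [hins] using hxK⟩).2
      · simp only [hins]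
      · obtain ⟨-, h1, h2, h3⟩ := mem_PK_append_cons.1 hxK
        refine mem_PK_append_cons.2 ⟨hsplit, h1, ?_, cubesIn_cons.2 ⟨?_, ?_⟩⟩
        · exact hK.cubeOn_mem h2 (by simpa using hmE) (by simp)
        · refine hK.cubeOn_mem h2 (Finset.erase_subset m E) fun a ha => ?_
          have : a ≠ m := by
            rintro rfl
            exact ha hmE
          simp [this]
        · rwa [Finset.union_assoc, ← Finset.insert_eq, hins]
  · rintro ⟨B, σ, τ, rfl, hxK, hmem⟩
    have hx := (mem_PK.1 hxK).1
    obtain ⟨hmσ, hmB, hmτ⟩ := notMem_of_isOPart_univ hx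
    refine ⟨⟨⟨hx, ?_⟩, hxK⟩, ?_⟩
    · rintro ⟨L, hL, hxL⟩
      have hmL : m ∉ blocksUnion L := by simp [hL.2.2]
      obtain ⟨-, -, h⟩ := append_cons_inj_of_mem (by simp) (by simp) hmσ hmL hxL
      simp at h
    · rintro p ⟨hp, -, hp2⟩
      obtain ⟨B', σ', τ', hp', rfl⟩ := mem_VrA.1 hp
      obtain ⟨hmσ', hmB', -⟩ := notMem_of_isOPart_univ hp'
      constructor
      · intro h
        obtain ⟨rfl, -, h⟩ := append_cons_inj_of_mem (by simp) (by simp) hmσ' hmσ h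
        obtain ⟨rfl, rfl⟩ := List.cons.inj h
        exact hmem (mem_PK_append_cons.1 hp2).2.2.1
      · intro h
        obtain ⟨-, h, -⟩ := append_cons_inj_of_mem (by simp) (by simp) hmσ' hmσ h
        obtain ⟨b, hb⟩ := (isOPart_univ_split_iff.1 hp').2.2.1
        have hbm : b ∈ ({m} : Finset A) := h ▸ Finset.mem_insert_of_mem hb
        exact hmB' (Finset.mem_singleton.1 hbm ▸ hb)

end RegularCells

/-- For an `A`-cubical complex `K` (`A` finite, nonempty, linearly
ordered, with maximum `m`), the critical cells of the vector field `V^r_K` on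
`P^r_K = P^r_A ∩ P_K` are exactly the cells `π|m|B|ρ` with `(C,B,D)` a branching
sequence of `K`, `π ∈ P_{K|⁰_C}` and `ρ ∈ P_{K|¹_D}`. -/
theorem stmt_9 {A : Type*} [LinearOrder A] [Fintype A] [Nonempty A]
    (K : Set (Cube A)) (hK : IsComplex K) :
    CritOn (PrA (mA A) ∩ PK K ∅ Finset.univ) (VrK K (mA A)) =
      {x | ∃ C B D : Finset A, IsBranch K (mA A) C B D ∧
        ∃ π ∈ PK K ∅ C, ∃ ρ ∈ PK K (Finset.univ \ D) D,
          x = π ++ [({mA A} : Finset A)] ++ [B] ++ ρ} := by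
  ext x
  rw [mem_critOn_iff hK]
  have compl : ∀ (B : Finset A) (σ τ : List (Finset A)),
      IsOPart Finset.univ (σ ++ {mA A} :: B :: τ) →
        blocksUnion σ ∪ {mA A} ∪ B = Finset.univ \ blocksUnion τ := by
    intro B σ τ h
    obtain ⟨-, -, hd, hu⟩ := isOPart_append.1
      (show IsOPart Finset.univ ((σ ++ [{mA A}, B]) ++ τ) by simpa using h)
    rw [← hu, Finset.union_sdiff_cancel_right hd]
    simp
  constructor
  · rintro ⟨B, σ, τ, rfl, hxK, hmem⟩
    obtain ⟨hx, h1, h2, h3⟩ := mem_PK_append_cons.1 hxK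
    obtain ⟨h3, h4⟩ := cubesIn_cons.1 h3
    obtain ⟨hσ, hτ, hB, d1, d2, d3, hu⟩ := isOPart_univ_split_iff.1 hx
    rw [compl B σ τ hx] at h4
    rw [Finset.union_comm, ← Finset.insert_eq] at h3
    exact ⟨_, B, _, ⟨hB, d1, d2, d3, hu, hmem, h2, h3⟩, σ, ⟨hσ, h1⟩, τ, ⟨hτ, h4⟩, by simp⟩
  · rintro ⟨C, B, D, ⟨hB, d1, d2, d3, hu, hmem, h2, h3⟩, σ, ⟨hσ, h1⟩, τ, ⟨hτ, h4⟩, rfl⟩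
    obtain rfl := hσ.2.2
    obtain rfl := hτ.2.2
    have hx := isOPart_univ_split_iff.2 ⟨hσ, hτ, hB, d1, d2, d3, hu⟩
    refine ⟨B, σ, τ, by simp, ?_, hmem⟩
    simp only [List.append_assoc, List.singleton_append]
    rw [Finset.insert_eq, Finset.union_comm] at h3
    refine mem_PK_append_cons.2 ⟨hx, h1, h2, cubesIn_cons.2 ⟨h3, ?_⟩⟩
    rw [compl B σ τ hx]
    exact h4
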